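/- Let v be harmonic on the half-space H, continuously differentiable up to the closure of H, vanishing on the hyperplane {z₁ = 0}, and not identically zero. Then the Almgren frequency N(v)(r) := (r^{2−N} ∫_{C_r} |∇v|²)/(r^{1−N} ∫_{Γ_r} v² dσ) is monotone nondecreasing with respect to r on (0, +∞). -/

import Mathlib

open MeasureTheory Filter Set Metric

noncomputable section

/-- The Laplacian on `ℝ^N` (as `EuclideanSpace`): sum of the pure second partial
derivatives. -/
def lapE {d : ℕ} (u : EuclideanSpace ℝ (Fin (d+2)) → ℝ) (z : EuclideanSpace ℝ (Fin (d+2))) : ℝ :=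
  ∑ i : Fin (d+2), fderiv ℝ (fun z' => fderiv ℝ u z' (EuclideanSpace.single i 1)) z
    (EuclideanSpace.single i 1)

/-- `|∇u|²`, the squared norm of the gradient. -/
def gradSqE {d : ℕ} (u : EuclideanSpace ℝ (Fin (d+2)) → ℝ) (z : EuclideanSpace ℝ (Fin (d+2))) : ℝ :=
  ∑ i : Fin (d+2), (fderiv ℝ u z (EuclideanSpace.single i 1))^2

/-- The open half-space `H = {z ∈ ℝ^N : z₁ > 0}`. -/
def HalfSpace (d : ℕ) : Set (EuclideanSpace ℝ (Fin (d+2))) :=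
  {z | 0 < z 0}

/-- A positive solution on the half-space `H`: continuous on the closure of `H`, twice
continuously differentiable and harmonic in `H`, positive in `H`, vanishing on `{z₁ = 0}`. -/
def IsPosSolHS {d : ℕ} (v : EuclideanSpace ℝ (Fin (d+2)) → ℝ) : Prop :=
  ContinuousOn v (closure (HalfSpace d)) ∧
  ContDiffOn ℝ 2 v (HalfSpace d) ∧
  (∀ z ∈ HalfSpace d, lapE v z = 0) ∧
  (∀ z ∈ HalfSpace d, 0 < v z) ∧
  (∀ z : EuclideanSpace ℝ (Fin (d+2)), z 0 = 0 → v z = 0)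

/-- The open upper unit hemisphere, as a subset of the unit sphere. -/
def Hemisphere (d : ℕ) : Set ↥(sphere (0 : EuclideanSpace ℝ (Fin (d+2))) 1) :=
  {θ | 0 < (θ : EuclideanSpace ℝ (Fin (d+2))) 0}

/-- The Almgren frequency on the half-space,
`N(v)(r) = (r^{2-N} ∫_{C_r} |∇v|²) / (r^{1-N} ∫_{Γ_r} v² dσ)`; here the boundary term
`r^{1-N} ∫_{Γ_r} v² dσ` is written, by the scaling property of the surface measure, as the
integral over the unit hemisphere `∫_{S^{N-1}_+} v(rθ)² dσ(θ)` with respect to the surface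
measure `volume.toSphere` on the unit sphere. -/
def freqHS {d : ℕ} (v : EuclideanSpace ℝ (Fin (d+2)) → ℝ) (r : ℝ) : ℝ :=
  (r ^ ((2:ℝ) - ((d:ℝ) + 2)) *
      ∫ z in HalfSpace d ∩ ball (0 : EuclideanSpace ℝ (Fin (d+2))) r, gradSqE v z) /
    (∫ θ in Hemisphere d, (v (r • (θ : EuclideanSpace ℝ (Fin (d+2)))))^2
      ∂((volume : Measure (EuclideanSpace ℝ (Fin (d+2)))).toSphere))


/-- The ambient Euclidean space `ℝ^N` with `N = d + 2`. -/
abbrev Euc (d : ℕ) : Type := EuclideanSpace ℝ (Fin (d + 2))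

/-- The Euclidean inner product of two linear forms. -/
def formDot {d : ℕ} (A B : Euc d →L[ℝ] ℝ) : ℝ :=
  ∑ i : Fin (d + 2), A (EuclideanSpace.single i 1) * B (EuclideanSpace.single i 1)

/-- The surface measure on the unit sphere. -/
abbrev surf (d : ℕ) : Measure (sphere (0 : Euc d) 1) := (volume : Measure (Euc d)).toSphere

/-- A harmonic function on the half-space which vanishes on the boundary hyperplane and has
a locally bounded gradient up to the boundary. -/
structure DirichletHarmonic {d : ℕ} (f : Euc d → ℝ) : Prop where
  contDiffOn : ContDiffOn ℝ 2 f (HalfSpace d)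
  lap_eq_zero : ∀ z ∈ HalfSpace d, lapE f z = 0
  bound : ∀ R : ℝ, ∃ C : ℝ, 0 ≤ C ∧ ∀ z ∈ HalfSpace d, ‖z‖ ≤ R →
    ‖fderiv ℝ f z‖ ≤ C ∧ |f z| ≤ C * z 0

section Basic

variable {d : ℕ}

lemma isOpen_halfSpace : IsOpen (HalfSpace d) :=
  isOpen_lt continuous_const (by fun_prop)

lemma measurableSet_halfSpace : MeasurableSet (HalfSpace d) := isOpen_halfSpace.measurableSet

lemma isOpen_hemisphere : IsOpen (Hemisphere d) :=
  isOpen_lt continuous_const (by fun_prop)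

lemma measurableSet_hemisphere : MeasurableSet (Hemisphere d) := isOpen_hemisphere.measurableSet

lemma smul_mem_halfSpace_iff {r : ℝ} (hr : 0 < r) (z : Euc d) :
    r • z ∈ HalfSpace d ↔ z ∈ HalfSpace d := by
  simp [HalfSpace, hr]

lemma ne_zero_of_mem_halfSpace {z : Euc d} (hz : z ∈ HalfSpace d) : z ≠ 0 := by
  rintro rfl
  simp [HalfSpace] at hz

lemma coord_zero_le_norm (z : Euc d) : z 0 ≤ ‖z‖ :=
  (le_abs_self _).trans (PiLp.norm_apply_le z 0)

lemma formDot_comm (A B : Euc d →L[ℝ] ℝ) : formDot A B = formDot B A := by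
  simp [formDot, mul_comm]

lemma formDot_add_left (A A' B : Euc d →L[ℝ] ℝ) :
    formDot (A + A') B = formDot A B + formDot A' B := by
  simp [formDot, add_mul, Finset.sum_add_distrib]

lemma formDot_smul_left (c : ℝ) (A B : Euc d →L[ℝ] ℝ) :
    formDot (c • A) B = c * formDot A B := by
  simp [formDot, Finset.mul_sum, mul_assoc]

lemma formDot_innerSL (z : Euc d) (B : Euc d →L[ℝ] ℝ) :
    formDot (innerSL ℝ z) B = B z := by
  have hz : z = ∑ i, z i • EuclideanSpace.single i (1 : ℝ) := by
    ext j
    simp [Finset.sum_apply, Pi.single_apply]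
  conv_rhs => rw [hz, map_sum]
  simp [formDot, EuclideanSpace.inner_single_right]

lemma formDot_proj_zero (B : Euc d →L[ℝ] ℝ) :
    formDot (EuclideanSpace.proj 0) B = B (EuclideanSpace.single 0 1) := by
  rw [formDot, Finset.sum_eq_single 0] <;> simp +contextual [eq_comm]

lemma abs_formDot_le (A B : Euc d →L[ℝ] ℝ) : |formDot A B| ≤ (d + 2) * (‖A‖ * ‖B‖) := by
  refine (Finset.abs_sum_le_sum_abs _ _).trans ?_
  refine (Finset.sum_le_card_nsmul _ _ (‖A‖ * ‖B‖) fun i _ => ?_).trans (by simp)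
  rw [abs_mul]
  gcongr
  · simpa using A.le_opNorm (EuclideanSpace.single i 1)
  · simpa using B.le_opNorm (EuclideanSpace.single i 1)

lemma continuous_formDot :
    Continuous fun p : (Euc d →L[ℝ] ℝ) × (Euc d →L[ℝ] ℝ) => formDot p.1 p.2 := by
  unfold formDot
  fun_prop

/-- Integration in polar coordinates. -/
lemma integral_polar {w : Euc d → ℝ} (hw : Integrable w) :
    ∫ z, w z = ∫ r in Ioi (0 : ℝ), r ^ (d + 1) * ∫ θ, w (r • (θ : Euc d)) ∂surf d := by
  have hdim : Module.finrank ℝ (Euc d) - 1 = d + 1 := by simp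
  have hmp := (volume : Measure (Euc d)).measurePreserving_homeomorphUnitSphereProd
  rw [hdim] at hmp
  set G : sphere (0 : Euc d) 1 × Ioi (0 : ℝ) → ℝ := fun p => w (p.2.1 • (p.1 : Euc d)) with hG
  have hcomp : ∀ x : ({(0 : Euc d)}ᶜ : Set (Euc d)), G (homeomorphUnitSphereProd (Euc d) x) = w x := by
    rintro ⟨x, hx⟩
    have : ‖x‖ ≠ 0 := by simpa using hx
    simp [hG, smul_smul, this]
  have h1 : ∫ z, w z = ∫ p, G p ∂((surf d).prod (.volumeIoiPow (d + 1))) := by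
    rw [← hmp.integral_comp (Homeomorph.measurableEmbedding _)]
    simp_rw [hcomp]
    rw [integral_subtype_comap (measurableSet_singleton _).compl w, restrict_compl_singleton]
  have hGi : Integrable G ((surf d).prod (.volumeIoiPow (d + 1))) := by
    rw [← hmp.integrable_comp_emb (Homeomorph.measurableEmbedding _)]
    have : (G ∘ homeomorphUnitSphereProd (Euc d)) = w ∘ Subtype.val := funext hcomp
    rw [this, ← integrableOn_iff_comap_subtypeVal (measurableSet_singleton _).compl]
    exact hw.integrableOn
  rw [h1, integral_prod_symm _ hGi]
  simp only [Measure.volumeIoiPow, ENNReal.ofReal]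
  rw [integral_withDensity_eq_integral_smul (measurable_subtype_coe.pow_const _).real_toNNReal,
    integral_subtype_comap measurableSet_Ioi
      fun a : ℝ => Real.toNNReal (a ^ (d + 1)) • ∫ θ, w (a • (θ : Euc d)) ∂surf d]
  refine setIntegral_congr_fun measurableSet_Ioi fun x hx => ?_
  simp only [NNReal.smul_def, smul_eq_mul]
  rw [Real.coe_toNNReal _ (pow_nonneg hx.out.le _)]

lemma setIntegral_halfSpace_polar {w : Euc d → ℝ} (hw : IntegrableOn w (HalfSpace d)) :
    ∫ z in HalfSpace d, w z =
      ∫ r in Ioi (0 : ℝ), r ^ (d + 1) * ∫ θ in Hemisphere d, w (r • (θ : Euc d)) ∂surf d := by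
  rw [← integral_indicator measurableSet_halfSpace,
    integral_polar ((integrable_indicator_iff measurableSet_halfSpace).2 hw)]
  refine setIntegral_congr_fun measurableSet_Ioi fun r hr => ?_
  rw [← integral_indicator measurableSet_hemisphere]
  congr 2 with θ
  have : r • (θ : Euc d) ∈ HalfSpace d ↔ θ ∈ Hemisphere d := smul_mem_halfSpace_iff hr _
  by_cases h : θ ∈ Hemisphere d <;> simp [indicator, this, h]

lemma integrable_mul_of_tsupport_subset {F w : Euc d → ℝ} (hF : Continuous F)
    (hFc : HasCompactSupport F) {U : Set (Euc d)} (hFs : tsupport F ⊆ U)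
    (hw : ContinuousOn w U) : Integrable fun z => F z * w z := by
  have : IntegrableOn (fun z => F z * w z) (tsupport F) :=
    (hF.continuousOn.mul (hw.mono hFs)).integrableOn_compact hFc
  refine (integrableOn_iff_integrable_of_support_subset ?_).1 this
  intro z hz
  exact subset_tsupport _ (left_ne_zero_of_mul hz)

lemma DirichletHarmonic.differentiableAt {f : Euc d → ℝ} (hf : DirichletHarmonic f) {z : Euc d}
    (hz : z ∈ HalfSpace d) : DifferentiableAt ℝ f z :=
  (hf.contDiffOn.contDiffAt (isOpen_halfSpace.mem_nhds hz)).differentiableAt (by norm_num)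

lemma DirichletHarmonic.continuousOn {f : Euc d → ℝ} (hf : DirichletHarmonic f) :
    ContinuousOn f (HalfSpace d) := hf.contDiffOn.continuousOn

lemma DirichletHarmonic.contDiffOn_fderiv {f : Euc d → ℝ} (hf : DirichletHarmonic f) :
    ContDiffOn ℝ 1 (fderiv ℝ f) (HalfSpace d) :=
  hf.contDiffOn.fderiv_of_isOpen isOpen_halfSpace (by norm_num)

lemma DirichletHarmonic.continuousOn_fderiv {f : Euc d → ℝ} (hf : DirichletHarmonic f) :
    ContinuousOn (fderiv ℝ f) (HalfSpace d) := hf.contDiffOn_fderiv.continuousOn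

lemma integral_formDot_eq_zero {F g : Euc d → ℝ} (hF : ContDiff ℝ 1 F)
    (hFc : HasCompactSupport F) (hFs : tsupport F ⊆ HalfSpace d) (hg : DirichletHarmonic g) :
    ∫ z, formDot (fderiv ℝ F z) (fderiv ℝ g z) = 0 := by
  have hF' : ∀ i : Fin (d + 2), Continuous fun z => fderiv ℝ F z (EuclideanSpace.single i 1) :=
    fun i => (hF.continuous_fderiv (by norm_num)).clm_apply continuous_const
  have hsub : ∀ i : Fin (d + 2),
      tsupport (fun z => fderiv ℝ F z (EuclideanSpace.single i 1)) ⊆ tsupport F := by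
    intro i
    refine (closure_mono ?_).trans (tsupport_fderiv_subset ℝ (f := F))
    intro z hz h
    exact hz (by simp [h])
  have hgi : ∀ i : Fin (d + 2), ContDiffOn ℝ 1
      (fun z => fderiv ℝ g z (EuclideanSpace.single i 1)) (HalfSpace d) :=
    fun i => hg.contDiffOn_fderiv.clm_apply contDiffOn_const
  have hint : ∀ i : Fin (d + 2), Integrable fun z => fderiv ℝ F z (EuclideanSpace.single i 1) *
      fderiv ℝ g z (EuclideanSpace.single i 1) := fun i =>
    integrable_mul_of_tsupport_subset (hF' i) (hFc.mono' ((subset_tsupport _).trans (hsub i)))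
      ((hsub i).trans hFs) (hgi i).continuousOn
  have hint2 : ∀ i : Fin (d + 2), Integrable fun z => F z *
      fderiv ℝ (fun z' => fderiv ℝ g z' (EuclideanSpace.single i 1)) z
        (EuclideanSpace.single i 1) := fun i =>
    integrable_mul_of_tsupport_subset hF.continuous hFc hFs
      (((hgi i).continuousOn_fderiv_of_isOpen isOpen_halfSpace (by norm_num)).clm_apply
        continuousOn_const)
  have key : ∀ i : Fin (d + 2), ∫ z, fderiv ℝ F z (EuclideanSpace.single i 1) *
      fderiv ℝ g z (EuclideanSpace.single i 1) = - ∫ z, F z *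
      fderiv ℝ (fun z' => fderiv ℝ g z' (EuclideanSpace.single i 1)) z
        (EuclideanSpace.single i 1) := by
    intro i
    rw [integral_mul_fderiv_eq_neg_fderiv_mul_of_integrable (hint i) (hint2 i)
      (integrable_mul_of_tsupport_subset hF.continuous hFc hFs (hgi i).continuousOn)
      (fun z _ => hF.differentiable (by norm_num) z)
      (fun z hz => ((hgi i).contDiffAt (isOpen_halfSpace.mem_nhds (hFs hz))).differentiableAt
        (by norm_num)), neg_neg]
  unfold formDot
  rw [integral_finsetSum _ fun i _ => hint i]
  simp_rw [key]
  rw [Finset.sum_neg_distrib, ← integral_finsetSum _ fun i _ => hint2 i, neg_eq_zero]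
  refine integral_eq_zero_of_ae (.of_forall fun z => ?_)
  simp only [← Finset.mul_sum]
  by_cases hz : z ∈ tsupport F
  · have := hg.lap_eq_zero z (hFs hz)
    simp only [lapE] at this
    simp [this]
  · simp [image_eq_zero_of_notMem_tsupport hz]

end Basic

section Green

variable {d : ℕ}

lemma integrableOn_halfSpace_of_bound {w : Euc d → ℝ} {R C : ℝ}
    (hw : ContinuousOn w (HalfSpace d))
    (hb : ∀ z ∈ HalfSpace d, ‖z‖ ≤ R → |w z| ≤ C)
    (h0 : ∀ z ∈ HalfSpace d, R < ‖z‖ → w z = 0) : IntegrableOn w (HalfSpace d) := by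
  have hg : Integrable ((closedBall (0 : Euc d) R).indicator fun _ => C)
      (volume.restrict (HalfSpace d)) := by
    refine ((integrable_indicator_iff measurableSet_closedBall).2 ?_).integrableOn
    exact integrableOn_const measure_closedBall_lt_top.ne
  refine hg.mono' (hw.aestronglyMeasurable measurableSet_halfSpace) ?_
  filter_upwards [ae_restrict_mem measurableSet_halfSpace] with z hz
  by_cases hR : ‖z‖ ≤ R
  · simpa [indicator, hR] using hb z hz hR
  · simp [indicator, hR, h0 z hz (not_le.1 hR)]

lemma exists_bound_mul_deriv_smoothTransition :
    ∃ C, 0 ≤ C ∧ ∀ t : ℝ, |t * deriv (fun s : ℝ => Real.smoothTransition (s - 1)) t| ≤ C := by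
  have hsm : ContDiff ℝ 1 fun s : ℝ => Real.smoothTransition (s - 1) :=
    Real.smoothTransition.contDiff.comp (contDiff_id.sub contDiff_const)
  obtain ⟨C, hC⟩ := (isCompact_Icc (a := (0 : ℝ)) (b := 3)).exists_bound_of_continuousOn
    (f := fun t => t * deriv (fun s : ℝ => Real.smoothTransition (s - 1)) t)
    (continuous_id.mul (hsm.continuous_deriv (by norm_num))).continuousOn
  have hC0 : 0 ≤ C := (norm_nonneg _).trans (hC 0 (by simp))
  refine ⟨C, hC0, fun t => ?_⟩
  by_cases ht : t ∈ Icc (0 : ℝ) 3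
  · exact hC t ht
  · have : deriv (fun s : ℝ => Real.smoothTransition (s - 1)) t = 0 := by
      rw [mem_Icc, not_and_or, not_le, not_le] at ht
      rcases ht with ht | ht
      · have : (fun s : ℝ => Real.smoothTransition (s - 1)) =ᶠ[nhds t] fun _ => 0 := by
          filter_upwards [Iio_mem_nhds ht] with s hs
          exact Real.smoothTransition.zero_of_nonpos (by linarith [mem_Iio.1 hs])
        simp [this.deriv_eq]
      · have : (fun s : ℝ => Real.smoothTransition (s - 1)) =ᶠ[nhds t] fun _ => 1 := by
          filter_upwards [Ioi_mem_nhds ht] with s hs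
          exact Real.smoothTransition.one_of_one_le (by linarith [mem_Ioi.1 hs])
        simp [this.deriv_eq]
    simpa [this] using hC0

lemma continuousOn_formDot_fderiv {f g : Euc d → ℝ} (hf : DirichletHarmonic f)
    (hg : DirichletHarmonic g) :
    ContinuousOn (fun z => formDot (fderiv ℝ f z) (fderiv ℝ g z)) (HalfSpace d) :=
  continuous_formDot.comp_continuousOn (hf.continuousOn_fderiv.prodMk hg.continuousOn_fderiv)

lemma continuousOn_mul_euler {f g : Euc d → ℝ} (hf : DirichletHarmonic f)
    (hg : DirichletHarmonic g) :
    ContinuousOn (fun z => f z * fderiv ℝ g z z) (HalfSpace d) :=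
  hf.continuousOn.mul (hg.continuousOn_fderiv.clm_apply continuousOn_id)

lemma exists_bound_formDot {f g : Euc d → ℝ} (hf : DirichletHarmonic f)
    (hg : DirichletHarmonic g) (R : ℝ) :
    ∃ C, 0 ≤ C ∧ ∀ z ∈ HalfSpace d, ‖z‖ ≤ R → |formDot (fderiv ℝ f z) (fderiv ℝ g z)| ≤ C := by
  obtain ⟨A, hA0, hA⟩ := hf.bound R
  obtain ⟨B, hB0, hB⟩ := hg.bound R
  refine ⟨(d + 2) * (A * B), by positivity, fun z hz hR => (abs_formDot_le _ _).trans ?_⟩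
  gcongr
  exacts [(hA z hz hR).1, (hB z hz hR).1]

lemma exists_bound_mul_euler {f g : Euc d → ℝ} (hf : DirichletHarmonic f)
    (hg : DirichletHarmonic g) (R : ℝ) :
    ∃ C, 0 ≤ C ∧ ∀ z ∈ HalfSpace d, ‖z‖ ≤ R → |f z * fderiv ℝ g z z| ≤ C * ‖z‖ := by
  obtain ⟨A, hA0, hA⟩ := hf.bound R
  obtain ⟨B, hB0, hB⟩ := hg.bound R
  refine ⟨A * |R| * B, by positivity, fun z hz hR => ?_⟩
  have h1 : |f z| ≤ A * |R| := (hA z hz hR).2.trans <| by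
    gcongr
    exact (coord_zero_le_norm z).trans (hR.trans (le_abs_self R))
  have h2 : |fderiv ℝ g z z| ≤ B * ‖z‖ := ((fderiv ℝ g z).le_opNorm z).trans <| by
    gcongr
    exact (hB z hz hR).1
  rw [abs_mul, mul_assoc _ B]
  gcongr

lemma hasFDerivAt_norm_of_ne_zero {E : Type*} [NormedAddCommGroup E] [InnerProductSpace ℝ E]
    {z : E} (hz : z ≠ 0) : HasFDerivAt (fun z : E => ‖z‖) (‖z‖⁻¹ • innerSL ℝ z) z := by
  have hnz : ‖z‖ ≠ 0 := norm_ne_zero_iff.2 hz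
  have := (hasStrictFDerivAt_norm_sq z).hasFDerivAt.sqrt (by positivity)
  simp only [Real.sqrt_sq (norm_nonneg _)] at this
  convert this using 1
  rw [← Nat.cast_smul_eq_nsmul ℝ, smul_smul]
  congr 1
  push_cast
  field_simp

/-- Green's identity against a radial weight. -/
lemma integral_radial_formDot {f g : Euc d → ℝ} (hf : DirichletHarmonic f)
    (hg : DirichletHarmonic g) {Φ κ : ℝ → ℝ} {M : ℝ} (hκ : Continuous κ)
    (hΦ : ∀ r, HasDerivAt Φ (-κ r) r) (hΦM : ∀ r, M ≤ r → Φ r = 0) (hκM : ∀ r, M ≤ r → κ r = 0) :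
    ∫ z in HalfSpace d, Φ ‖z‖ * formDot (fderiv ℝ f z) (fderiv ℝ g z) =
      ∫ z in HalfSpace d, κ ‖z‖ / ‖z‖ * (f z * fderiv ℝ g z z) := by
  set χ : ℝ → ℝ := fun s => Real.smoothTransition (s - 1) with hχ
  have hχs : ContDiff ℝ 1 χ :=
    Real.smoothTransition.contDiff.comp (contDiff_id.sub contDiff_const)
  have hΦs : ContDiff ℝ 1 Φ := by
    rw [contDiff_one_iff_deriv]
    refine ⟨fun r => (hΦ r).differentiableAt, ?_⟩
    rw [show deriv Φ = fun r => -κ r from funext fun r => (hΦ r).deriv]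
    exact hκ.neg
  obtain ⟨Cχ, hCχ0, hCχ⟩ := exists_bound_mul_deriv_smoothTransition
  obtain ⟨Ca, hCa0, hCa⟩ := exists_bound_formDot hf hg M
  obtain ⟨Cb, hCb0, hCb⟩ := exists_bound_mul_euler hf hg M
  obtain ⟨Cf, hCf0, hCf⟩ := hf.bound M
  obtain ⟨Cg, hCg0, hCg⟩ := hg.bound M
  obtain ⟨CΦ, hCΦ⟩ := (isCompact_Icc (a := (0 : ℝ)) (b := |M|)).exists_bound_of_continuousOn
    hΦs.continuous.continuousOn
  obtain ⟨Cκ, hCκ⟩ := (isCompact_Icc (a := (0 : ℝ)) (b := |M|)).exists_bound_of_continuousOn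
    hκ.continuousOn
  have hCΦ0 : 0 ≤ CΦ := (norm_nonneg _).trans (hCΦ 0 (by simp))
  have hCκ0 : 0 ≤ Cκ := (norm_nonneg _).trans (hCκ 0 (by simp))
  have hmemM : ∀ z : Euc d, ‖z‖ ≤ M → ‖z‖ ∈ Icc (0 : ℝ) |M| := fun z hz =>
    ⟨norm_nonneg _, hz.trans (le_abs_self M)⟩
  have hb1 : ∀ z ∈ HalfSpace d, ‖z‖ ≤ M →
      |Φ ‖z‖ * formDot (fderiv ℝ f z) (fderiv ℝ g z)| ≤ CΦ * Ca := by
    intro z hz hzM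
    rw [abs_mul]
    exact mul_le_mul (hCΦ _ (hmemM z hzM)) (hCa z hz hzM) (abs_nonneg _) hCΦ0
  have hb2 : ∀ z ∈ HalfSpace d, ‖z‖ ≤ M →
      |κ ‖z‖ / ‖z‖ * (f z * fderiv ℝ g z z)| ≤ Cκ * Cb := by
    intro z hz hzM
    have hz0 : 0 < ‖z‖ := norm_pos_iff.2 (ne_zero_of_mem_halfSpace hz)
    rw [abs_mul, abs_div, abs_norm]
    calc |κ ‖z‖| / ‖z‖ * |f z * fderiv ℝ g z z| ≤ Cκ / ‖z‖ * (Cb * ‖z‖) := by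
          gcongr
          exacts [hCκ _ (hmemM z hzM), hCb z hz hzM]
      _ = Cκ * Cb := by field_simp
  have hc1 : ContinuousOn (fun z => Φ ‖z‖ * formDot (fderiv ℝ f z) (fderiv ℝ g z))
      (HalfSpace d) :=
    (hΦs.continuous.comp continuous_norm).continuousOn.mul (continuousOn_formDot_fderiv hf hg)
  have hc2 : ContinuousOn (fun z => κ ‖z‖ / ‖z‖ * (f z * fderiv ℝ g z z)) (HalfSpace d) :=
    ((hκ.comp continuous_norm).continuousOn.div continuous_norm.continuousOn fun z hz =>
      norm_ne_zero_iff.2 (ne_zero_of_mem_halfSpace hz)).mul (continuousOn_mul_euler hf hg)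
  have hi1 := integrableOn_halfSpace_of_bound hc1 hb1
    fun z _ h => by simp [hΦM _ h.le]
  have hi2 := integrableOn_halfSpace_of_bound hc2 hb2
    fun z _ h => by simp [hκM _ h.le]
  set F : ℕ → Euc d → ℝ := fun n z => χ ((n + 1) * z 0) * (Φ ‖z‖ * f z) with hF
  have hFsupp : ∀ n, tsupport (F n) ⊆ {z : Euc d | 1 ≤ (n + 1) * z 0} ∩ closedBall 0 M := by
    intro n
    refine closure_minimal (fun z hz => ⟨?_, ?_⟩) ?_
    · by_contra h
      refine hz ?_
      have : χ ((n + 1) * z 0) = 0 :=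
        Real.smoothTransition.zero_of_nonpos (by
        have h : ¬ 1 ≤ ((n : ℝ) + 1) * z 0 := h
        linarith [not_le.1 h])
      simp [hF, this]
    · by_contra h
      refine hz ?_
      have : M ≤ ‖z‖ := by simpa using (not_le.1 (by simpa using h)).le
      simp [hF, hΦM _ this]
    · exact (isClosed_le continuous_const (by fun_prop)).inter isClosed_closedBall
  have hFH : ∀ n, tsupport (F n) ⊆ HalfSpace d := by
    intro n z hz
    have h1 : 1 ≤ ((n : ℝ) + 1) * z 0 := (hFsupp n hz).1
    have h2 : (0 : ℝ) < n + 1 := by positivity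
    exact pos_of_mul_pos_right (by linarith) h2.le
  have hFc : ∀ n, HasCompactSupport (F n) := fun n =>
    (isCompact_closedBall (0 : Euc d) M).of_isClosed_subset (isClosed_tsupport _)
      fun z hz => (hFsupp n hz).2
  have hFs : ∀ n, ContDiff ℝ 1 (F n) := by
    intro n
    refine contDiff_iff_contDiffAt.2 fun z => ?_
    by_cases hz : z ∈ tsupport (F n)
    swap
    · exact contDiffAt_const.congr_of_eventuallyEq (notMem_tsupport_iff_eventuallyEq.1 hz)
    have hz := hFH n hz
    have h1 : ContDiffAt ℝ 1 (fun z : Euc d => ((n : ℝ) + 1) * z 0) z := by fun_prop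
    exact (hχs.contDiffAt.comp z h1).mul
      ((hΦs.contDiffAt.comp z (contDiffAt_norm ℝ (ne_zero_of_mem_halfSpace hz))).mul
      ((hf.contDiffOn.contDiffAt (isOpen_halfSpace.mem_nhds hz)).of_le (by norm_num)))
  set T : ℕ → Euc d → ℝ := fun n z =>
    χ ((n + 1) * z 0) * (Φ ‖z‖ * formDot (fderiv ℝ f z) (fderiv ℝ g z) -
      κ ‖z‖ / ‖z‖ * (f z * fderiv ℝ g z z)) +
    Φ ‖z‖ * f z * ((n + 1) * deriv χ ((n + 1) * z 0)) *
      fderiv ℝ g z (EuclideanSpace.single 0 1) with hT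
  have hFT : ∀ n, ∀ z ∈ HalfSpace d, formDot (fderiv ℝ (F n) z) (fderiv ℝ g z) = T n z := by
    intro n z hz
    have hz0 := ne_zero_of_mem_halfSpace hz
    have hnz : ‖z‖ ≠ 0 := norm_ne_zero_iff.2 hz0
    have h1 : HasFDerivAt (fun z : Euc d => ((n : ℝ) + 1) * z 0)
        (((n : ℝ) + 1) • (EuclideanSpace.proj 0 : Euc d →L[ℝ] ℝ)) z :=
      (EuclideanSpace.proj (𝕜 := ℝ) (0 : Fin (d + 2))).hasFDerivAt.const_mul _
    have h2 : HasFDerivAt (fun z : Euc d => χ (((n : ℝ) + 1) * z 0)) _ z :=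
      (hχs.differentiable (by norm_num) _).hasDerivAt.comp_hasFDerivAt z h1
    have h3 : HasFDerivAt (fun z : Euc d => ‖z‖) (‖z‖⁻¹ • innerSL ℝ z) z :=
      hasFDerivAt_norm_of_ne_zero hz0
    have h4 := (hΦ ‖z‖).comp_hasFDerivAt z h3
    have h5 := h2.mul (h4.mul (hf.differentiableAt hz).hasFDerivAt)
    have h6 : fderiv ℝ (F n) z = _ := h5.fderiv
    rw [h6]
    simp only [formDot_add_left, formDot_smul_left, formDot_innerSL, formDot_proj_zero, hT,
      Function.comp_apply, Pi.mul_apply]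
    field_simp
    ring
  have hT0 : ∀ n, ∫ z in HalfSpace d, T n z = 0 := by
    intro n
    rw [← integral_formDot_eq_zero (hFs n) (hFc n) (hFH n) hg,
      ← setIntegral_congr_fun measurableSet_halfSpace (hFT n)]
    refine setIntegral_eq_integral_of_forall_compl_eq_zero fun z hz => ?_
    have h0 : fderiv ℝ (F n) z = 0 := image_eq_zero_of_notMem_tsupport fun h =>
      hz (hFH n (tsupport_fderiv_subset ℝ h))
    simp [h0, formDot]
  have hTc : ∀ n, ContinuousOn (T n) (HalfSpace d) := by
    intro n
    have hl : Continuous fun z : Euc d => ((n : ℝ) + 1) * z 0 := by fun_prop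
    refine ((hχs.continuous.comp hl).continuousOn.mul (hc1.sub hc2)).add ?_
    refine ((((hΦs.continuous.comp continuous_norm).continuousOn.mul hf.continuousOn).mul
      (continuousOn_const.mul ((hχs.continuous_deriv (by norm_num)).comp hl).continuousOn))).mul ?_
    exact hg.continuousOn_fderiv.clm_apply continuousOn_const
  have hlim := tendsto_integral_of_dominated_convergence (μ := volume.restrict (HalfSpace d))
    (F := T) (f := fun z => Φ ‖z‖ * formDot (fderiv ℝ f z) (fderiv ℝ g z) -
      κ ‖z‖ / ‖z‖ * (f z * fderiv ℝ g z z))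
    ((closedBall (0 : Euc d) M).indicator fun _ => CΦ * Ca + Cκ * Cb + CΦ * Cf * Cχ * Cg)
    (fun n => (hTc n).aestronglyMeasurable measurableSet_halfSpace)
    (by
      refine ((integrable_indicator_iff measurableSet_closedBall).2 ?_).integrableOn
      exact integrableOn_const measure_closedBall_lt_top.ne)
    (by
      intro n
      filter_upwards [ae_restrict_mem measurableSet_halfSpace] with z hz
      by_cases hzM : ‖z‖ ≤ M
      · have e1 := hb1 z hz hzM
        have e2 := hb2 z hz hzM
        have e3 : |χ ((n + 1) * z 0)| ≤ 1 := by
          rw [abs_of_nonneg (Real.smoothTransition.nonneg _)]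
          exact Real.smoothTransition.le_one _
        have e4 : |fderiv ℝ g z (EuclideanSpace.single 0 1)| ≤ Cg := by
          have := (fderiv ℝ g z).le_opNorm (EuclideanSpace.single 0 1)
          simp only [Real.norm_eq_abs, PiLp.norm_single, abs_one, mul_one] at this
          exact this.trans (hCg z hz hzM).1
        have hn : (0 : ℝ) < n + 1 := by positivity
        have hz0 : 0 < z 0 := hz
        have e5 : |f z * ((n + 1) * deriv χ ((n + 1) * z 0))| ≤ Cf * Cχ := by
          calc |f z * ((n + 1) * deriv χ ((n + 1) * z 0))|
              = |f z| * ((n + 1) * |deriv χ ((n + 1) * z 0)|) := by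
                rw [abs_mul, abs_mul, abs_of_pos hn]
            _ ≤ Cf * z 0 * ((n + 1) * |deriv χ ((n + 1) * z 0)|) := by
                gcongr
                exact (hCf z hz hzM).2
            _ = Cf * |((n + 1) * z 0) * deriv χ ((n + 1) * z 0)| := by
                rw [abs_mul, abs_mul, abs_of_pos hn, abs_of_pos hz0]; ring
            _ ≤ _ := by
                gcongr
                exact hCχ _
        simp only [indicator, mem_closedBall, dist_zero_right, hzM, if_true, Real.norm_eq_abs]
        refine (abs_add_le _ _).trans (add_le_add ?_ ?_)
        · rw [abs_mul]
          calc _ ≤ 1 * (CΦ * Ca + Cκ * Cb) := by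
                refine mul_le_mul e3 ((abs_sub _ _).trans (add_le_add e1 e2)) (abs_nonneg _)
                  zero_le_one
            _ = _ := one_mul _
        · rw [abs_mul, mul_assoc (Φ ‖z‖), abs_mul, mul_assoc CΦ]
          have e6 := hCΦ _ (hmemM z hzM)
          rw [Real.norm_eq_abs] at e6
          gcongr
      · have hM := (not_le.1 hzM).le
        simp [hT, indicator, hzM, hΦM _ hM, hκM _ hM])
    (by
      filter_upwards [ae_restrict_mem measurableSet_halfSpace] with z hz
      have hz0 : 0 < z 0 := hz
      refine tendsto_const_nhds.congr' ?_
      have htend : Tendsto (fun n : ℕ => ((n : ℝ) + 1) * z 0) atTop atTop :=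
        (tendsto_atTop_add_const_right _ _ tendsto_natCast_atTop_atTop).atTop_mul_const hz0
      filter_upwards [htend.eventually_gt_atTop 2] with n hn
      have h1 : χ =ᶠ[nhds (((n : ℝ) + 1) * z 0)] fun _ => 1 := by
        filter_upwards [Ioi_mem_nhds hn] with s hs
        exact Real.smoothTransition.one_of_one_le (by linarith [mem_Ioi.1 hs])
      simp [hT, h1.deriv_eq, h1.eq_of_nhds])
  simp_rw [hT0] at hlim
  have := tendsto_nhds_unique hlim tendsto_const_nhds
  rw [integral_sub hi1 hi2] at this
  exact sub_eq_zero.1 this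

end Green

section Spherical

variable {d : ℕ}

lemma hemisphere_smul_mem {r : ℝ} (hr : 0 < r) {θ : sphere (0 : Euc d) 1}
    (hθ : θ ∈ Hemisphere d) : r • (θ : Euc d) ∈ HalfSpace d :=
  (smul_mem_halfSpace_iff hr _).2 hθ

lemma norm_smul_sphere {r : ℝ} (hr : 0 < r) (θ : sphere (0 : Euc d) 1) :
    ‖r • (θ : Euc d)‖ = r := by
  simp [norm_smul, abs_of_pos hr]

lemma continuousOn_comp_smul {X : Type*} [TopologicalSpace X] {u : Euc d → X}
    (hu : ContinuousOn u (HalfSpace d)) {r : ℝ} (hr : 0 < r) :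
    ContinuousOn (fun θ : sphere (0 : Euc d) 1 => u (r • (θ : Euc d))) (Hemisphere d) :=
  hu.comp (by fun_prop) fun _ hθ => hemisphere_smul_mem hr hθ

lemma continuousOn_integral_hemisphere {u : Euc d → ℝ} (hu : ContinuousOn u (HalfSpace d))
    (hb : ∀ R : ℝ, ∃ C, ∀ z ∈ HalfSpace d, ‖z‖ ≤ R → |u z| ≤ C) :
    ContinuousOn (fun r : ℝ => ∫ θ in Hemisphere d, u (r • (θ : Euc d)) ∂surf d) (Ioi 0) := by
  intro r hr
  refine ContinuousAt.continuousWithinAt ?_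
  obtain ⟨C, hC⟩ := hb (r + 1)
  have hnear : ∀ᶠ s in nhds r, 0 < s ∧ s < r + 1 :=
    (show ∀ᶠ s in nhds r, 0 < s from Ioi_mem_nhds hr).and (Iio_mem_nhds (lt_add_one r))
  refine continuousAt_of_dominated (bound := fun _ => C) ?_ ?_ (integrable_const C) ?_
  · filter_upwards [hnear] with s hs
    exact (continuousOn_comp_smul hu hs.1).aestronglyMeasurable measurableSet_hemisphere
  · filter_upwards [hnear] with s hs
    filter_upwards [ae_restrict_mem measurableSet_hemisphere] with θ hθ
    exact hC _ (hemisphere_smul_mem hs.1 hθ) (by rw [norm_smul_sphere hs.1]; exact hs.2.le)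
  · filter_upwards [ae_restrict_mem measurableSet_hemisphere] with θ hθ
    have h1 := hu.continuousAt (isOpen_halfSpace.mem_nhds (hemisphere_smul_mem hr hθ))
    have h2 : ContinuousAt (fun s : ℝ => s • (θ : Euc d)) r := by fun_prop
    exact ContinuousAt.comp (f := fun s : ℝ => s • (θ : Euc d)) h1 h2

lemma setIntegral_halfBall (w : Euc d → ℝ) (r : ℝ) :
    ∫ z in HalfSpace d ∩ ball (0 : Euc d) r, w z =
      ∫ z in HalfSpace d, (ball (0 : Euc d) r).indicator w z :=
  (setIntegral_indicator measurableSet_ball).symm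

lemma continuous_integral_halfBall {w : Euc d → ℝ} (hw : ContinuousOn w (HalfSpace d))
    (hb : ∀ R : ℝ, ∃ C, ∀ z ∈ HalfSpace d, ‖z‖ ≤ R → |w z| ≤ C) :
    Continuous (fun r : ℝ => ∫ z in HalfSpace d ∩ ball (0 : Euc d) r, w z) := by
  simp_rw [setIntegral_halfBall]
  refine continuous_iff_continuousAt.2 fun r => ?_
  obtain ⟨C, hC⟩ := hb (r + 1)
  refine continuousAt_of_dominated
    (bound := (closedBall (0 : Euc d) (r + 1)).indicator fun _ => |C|) ?_ ?_ ?_ ?_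
  · exact .of_forall fun s =>
      (hw.aestronglyMeasurable measurableSet_halfSpace).indicator measurableSet_ball
  · filter_upwards [Iio_mem_nhds (lt_add_one r)] with s hs
    filter_upwards [ae_restrict_mem measurableSet_halfSpace] with z hz
    by_cases h : ‖z‖ < s
    · have h' : ‖z‖ ≤ r + 1 := h.le.trans (le_of_lt hs)
      simpa [indicator, h, h'] using (hC z hz h').trans (le_abs_self C)
    · simp only [indicator, mem_ball, dist_zero_right, h, if_false, norm_zero]
      split_ifs <;> simp
  · refine ((integrable_indicator_iff measurableSet_closedBall).2 ?_).integrableOn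
    exact integrableOn_const measure_closedBall_lt_top.ne
  · have hsph : ∀ᵐ z : Euc d, z ∉ sphere (0 : Euc d) r :=
      measure_eq_zero_iff_ae_notMem.1 (Measure.addHaar_sphere _ _ _)
    filter_upwards [ae_restrict_of_ae hsph] with z hz
    have hz : ‖z‖ ≠ r := by simpa using hz
    rcases lt_or_gt_of_ne hz with h | h
    · refine (continuousAt_const (y := w z)).congr ?_
      filter_upwards [Ioi_mem_nhds h] with s hs
      simp [indicator, mem_Ioi.1 hs]
    · refine (continuousAt_const (y := (0 : ℝ))).congr ?_
      filter_upwards [Iio_mem_nhds h] with s hs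
      simp [indicator, (le_of_lt (mem_Iio.1 hs)).not_gt]

lemma integral_primitive_norm {w : Euc d → ℝ} (hw : ContinuousOn w (HalfSpace d))
    (hb : ∀ R : ℝ, ∃ C, ∀ z ∈ HalfSpace d, ‖z‖ ≤ R → |w z| ≤ C)
    {κ : ℝ → ℝ} {M : ℝ} (hκ : Continuous κ) (hκM : ∀ r, M ≤ r → κ r = 0) :
    ∫ z in HalfSpace d, (∫ s in ‖z‖..M, κ s) * w z =
      ∫ s in Ioi (0 : ℝ), κ s * ∫ z in HalfSpace d ∩ ball (0 : Euc d) s, w z := by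
  obtain ⟨C, hC⟩ := hb M
  have hκi : IntegrableOn κ (Ioi 0) := by
    have : IntegrableOn κ (Icc 0 M) := hκ.continuousOn.integrableOn_compact isCompact_Icc
    refine this.of_forall_sdiff_eq_zero measurableSet_Ioi fun s hs => hκM s ?_
    by_contra h
    exact hs.2 ⟨(mem_Ioi.1 hs.1).le, (not_le.1 h).le⟩
  have hwi : IntegrableOn ((ball (0 : Euc d) M).indicator w) (HalfSpace d) := by
    have h1 : IntegrableOn w (HalfSpace d ∩ ball (0 : Euc d) M) := by
      refine Integrable.mono' (g := fun _ => C) ?_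
        ((hw.mono inter_subset_left).aestronglyMeasurable
          (measurableSet_halfSpace.inter measurableSet_ball)) ?_
      · exact integrableOn_const ((measure_mono inter_subset_right).trans_lt measure_ball_lt_top).ne
      · filter_upwards [ae_restrict_mem (measurableSet_halfSpace.inter measurableSet_ball)]
          with z hz
        exact hC z hz.1 (by simpa using (mem_ball_zero_iff.1 hz.2).le)
    rwa [IntegrableOn, integrable_indicator_iff measurableSet_ball, IntegrableOn,
      Measure.restrict_restrict measurableSet_ball, inter_comm]
  set G : Euc d → ℝ → ℝ := fun z s => {p : Euc d × ℝ | ‖p.1‖ < p.2}.indicator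
    (fun p => (ball (0 : Euc d) M).indicator w p.1 * κ p.2) (z, s) with hG
  have hGv : ∀ z s, G z s = κ s * (ball (0 : Euc d) s).indicator w z := by
    intro z s
    by_cases h : ‖z‖ < s
    · by_cases hs : s < M
      · simp [hG, indicator, h, h.trans hs, mul_comm]
      · simp [hG, indicator, h, hκM s (not_lt.1 hs)]
    · simp [hG, indicator, h]
  have hGi : Integrable (Function.uncurry G)
      ((volume.restrict (HalfSpace d)).prod (volume.restrict (Ioi 0))) :=
    (hwi.mul_prod hκi).indicator
      (measurableSet_lt (measurable_fst.norm) measurable_snd)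
  have hswap := integral_integral_swap hGi
  calc ∫ z in HalfSpace d, (∫ s in ‖z‖..M, κ s) * w z
      = ∫ z in HalfSpace d, ∫ s in Ioi (0 : ℝ), G z s := by
        refine integral_congr_ae (.of_forall fun z => ?_)
        have h1 : ∀ s, G z s = (Ioi ‖z‖).indicator κ s * w z := by
          intro s
          rw [hGv]
          by_cases h : ‖z‖ < s <;> simp [indicator, h]
        simp only [h1]
        rw [integral_mul_const, setIntegral_indicator measurableSet_Ioi,
          inter_eq_right.2 (Ioi_subset_Ioi (norm_nonneg z))]
        congr 1
        rcases le_total ‖z‖ M with h | h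
        · rw [intervalIntegral.integral_of_le h]
          refine (setIntegral_eq_of_subset_of_forall_sdiff_eq_zero measurableSet_Ioi
            Ioc_subset_Ioi_self fun s hs => hκM s ?_).symm
          by_contra h'
          exact hs.2 ⟨hs.1, (not_le.1 h').le⟩
        · rw [intervalIntegral.integral_of_ge h, setIntegral_eq_zero_of_forall_eq_zero,
            setIntegral_eq_zero_of_forall_eq_zero, neg_zero]
          · exact fun s hs => hκM s (h.trans (mem_Ioi.1 hs).le)
          · exact fun s hs => hκM s hs.1.le
    _ = ∫ s in Ioi (0 : ℝ), ∫ z in HalfSpace d, G z s := hswap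
    _ = _ := by
        refine integral_congr_ae (.of_forall fun s => ?_)
        simp only [hGv, setIntegral_halfBall]
        rw [integral_const_mul]

/-- Green's first identity on half-balls for functions vanishing on the flat boundary. -/
lemma green_halfBall {f g : Euc d → ℝ} (hf : DirichletHarmonic f) (hg : DirichletHarmonic g)
    {r : ℝ} (hr : 0 < r) :
    r ^ d * ∫ θ in Hemisphere d, f (r • (θ : Euc d)) *
        fderiv ℝ g (r • (θ : Euc d)) (r • (θ : Euc d)) ∂surf d =
      ∫ z in HalfSpace d ∩ ball (0 : Euc d) r, formDot (fderiv ℝ f z) (fderiv ℝ g z) := by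
  have hwb : ∀ R : ℝ, ∃ C, ∀ z ∈ HalfSpace d, ‖z‖ ≤ R →
      |formDot (fderiv ℝ f z) (fderiv ℝ g z)| ≤ C := fun R =>
    (exists_bound_formDot hf hg R).imp fun _ h => h.2
  have hub : ∀ R : ℝ, ∃ C, ∀ z ∈ HalfSpace d, ‖z‖ ≤ R → |f z * fderiv ℝ g z z| ≤ C := by
    intro R
    obtain ⟨C, hC0, hC⟩ := exists_bound_mul_euler hf hg R
    exact ⟨C * R, fun z hz hzR => (hC z hz hzR).trans (by gcongr)⟩
  have hDc := continuous_integral_halfBall (continuousOn_formDot_fderiv hf hg) hwb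
  have hUc := continuousOn_integral_hemisphere (continuousOn_mul_euler hf hg) hub
  set D : ℝ → ℝ := fun s =>
    ∫ z in HalfSpace d ∩ ball (0 : Euc d) s, formDot (fderiv ℝ f z) (fderiv ℝ g z) with hD
  set U : ℝ → ℝ := fun s => ∫ θ in Hemisphere d, f (s • (θ : Euc d)) *
        fderiv ℝ g (s • (θ : Euc d)) (s • (θ : Euc d)) ∂surf d with hU
  have hcont : ContinuousOn (fun s => s ^ d * U s - D s) (Ioi 0) :=
    ((continuous_pow d).continuousOn.mul hUc).sub hDc.continuousOn
  have hae := isOpen_Ioi.ae_eq_zero_of_integral_contDiff_smul_eq_zero (μ := volume)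
    (hcont.locallyIntegrableOn measurableSet_Ioi) (fun κ hκ hκc hκs => by
      have hκ0 : ∀ s, s ∉ Ioi (0 : ℝ) → κ s = 0 := fun s hs =>
        image_eq_zero_of_notMem_tsupport fun h => hs (hκs h)
      obtain ⟨M, hM⟩ := hκc.isCompact.isBounded.subset_closedBall (0 : ℝ)
      have hκM : ∀ s, M + 1 ≤ s → κ s = 0 := fun s hs =>
        image_eq_zero_of_notMem_tsupport fun h => by
          have := hM h
          simp only [mem_closedBall, dist_zero_right, Real.norm_eq_abs] at this
          linarith [le_abs_self s]
      have hκi : ∀ v : ℝ → ℝ, ContinuousOn v (Ioi 0) →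
          IntegrableOn (fun s => κ s * v s) (Ioi 0) := by
        intro v hv
        have h1 : IntegrableOn (fun s => κ s * v s) (tsupport κ) :=
          (hκ.continuous.continuousOn.mul (hv.mono hκs)).integrableOn_compact hκc
        refine h1.of_forall_sdiff_eq_zero measurableSet_Ioi fun s hs => ?_
        simp [image_eq_zero_of_notMem_tsupport hs.2]
      have hΦ : ∀ s, HasDerivAt (fun a => ∫ t in a..(M + 1), κ t) (-κ s) s := fun s =>
        intervalIntegral.integral_hasDerivAt_left (hκ.continuous.intervalIntegrable _ _)
          (hκ.continuous.stronglyMeasurableAtFilter _ _) hκ.continuous.continuousAt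
      have hgreen := integral_radial_formDot hf hg hκ.continuous hΦ (M := M + 1)
        (fun s hs => by
          rw [intervalIntegral.integral_of_ge hs, setIntegral_eq_zero_of_forall_eq_zero, neg_zero]
          exact fun t ht => hκM t ht.1.le) hκM
      rw [integral_primitive_norm (continuousOn_formDot_fderiv hf hg) hwb hκ.continuous hκM]
        at hgreen
      obtain ⟨Cκ, hCκ⟩ := hκ.continuous.bounded_above_of_compact_support hκc
      obtain ⟨Cb, hCb0, hCb⟩ := exists_bound_mul_euler hf hg (M + 1)
      rw [setIntegral_halfSpace_polar (integrableOn_halfSpace_of_bound (R := M + 1)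
        (C := Cκ * Cb) ?_ ?_ ?_)] at hgreen
      · have h2 : ∫ s, κ s • (s ^ d * U s - D s) =
            ∫ s in Ioi (0 : ℝ), (κ s * (s ^ d * U s) - κ s * D s) := by
          rw [← setIntegral_eq_integral_of_forall_compl_eq_zero (s := Ioi (0 : ℝ))
            fun s hs => by simp [hκ0 s hs]]
          simp only [smul_eq_mul, mul_sub]
        rw [h2, integral_sub (hκi (fun s => s ^ d * U s) ((continuous_pow d).continuousOn.mul hUc))
          (hκi _ hDc.continuousOn), hgreen, sub_eq_zero]
        refine setIntegral_congr_fun measurableSet_Ioi fun s hs => ?_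
        have hs : 0 < s := hs
        simp only [norm_smul_sphere hs, hU]
        rw [integral_const_mul]
        field_simp
        ring
      · exact ((hκ.continuous.comp continuous_norm).continuousOn.div
          continuous_norm.continuousOn fun z hz =>
            norm_ne_zero_iff.2 (ne_zero_of_mem_halfSpace hz)).mul (continuousOn_mul_euler hf hg)
      · intro z hz hzM
        have hz0 : 0 < ‖z‖ := norm_pos_iff.2 (ne_zero_of_mem_halfSpace hz)
        have hCκ0 : 0 ≤ Cκ := (norm_nonneg _).trans (hCκ 0)
        rw [abs_mul, abs_div, abs_norm]
        calc |κ ‖z‖| / ‖z‖ * |f z * fderiv ℝ g z z| ≤ Cκ / ‖z‖ * (Cb * ‖z‖) := by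
              gcongr
              exacts [hCκ _, hCb z hz hzM]
          _ = Cκ * Cb := by field_simp
      · intro z _ h
        simp [hκM _ h.le])
  have heq := Measure.eqOn_open_of_ae_eq (μ := volume)
    ((ae_restrict_iff' measurableSet_Ioi).2 hae) isOpen_Ioi hcont continuousOn_const
  exact sub_eq_zero.1 (heq hr)

end Spherical

section Frequency

variable {d : ℕ}

lemma convex_halfSpace : Convex ℝ (HalfSpace d) := by
  intro x hx y hy a b ha hb hab
  have hx : 0 < x 0 := hx
  have hy : 0 < y 0 := hy
  change 0 < (a • x + b • y) 0
  simp only [PiLp.add_apply, PiLp.smul_apply, smul_eq_mul]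
  rcases ha.eq_or_lt with rfl | ha
  · have : b = 1 := by linarith
    simpa [this] using hy
  · positivity

lemma sub_coord_mem_closure (z : Euc d) :
    z - z 0 • EuclideanSpace.single 0 1 ∈ closure (HalfSpace d) := by
  refine map_mem_closure (f := fun t : ℝ => z - t • EuclideanSpace.single 0 (1 : ℝ))
    (s := Iio (z 0)) (by fun_prop) (by simp) fun t ht => ?_
  have ht : t < z 0 := ht
  simpa [HalfSpace] using ht

lemma dirichletHarmonic_of_contDiffOn_closure {v : Euc d → ℝ}
    (hC2 : ContDiffOn ℝ 2 v (HalfSpace d)) (hharm : ∀ z ∈ HalfSpace d, lapE v z = 0)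
    (hC1 : ContDiffOn ℝ 1 v (closure (HalfSpace d))) (hbd : ∀ z : Euc d, z 0 = 0 → v z = 0) :
    DirichletHarmonic v where
  contDiffOn := hC2
  lap_eq_zero := hharm
  bound := by
    intro R
    set K := closure (HalfSpace d) with hK
    have hKconv : Convex ℝ K := convex_halfSpace.closure
    have hsub : HalfSpace d ⊆ K := subset_closure
    have hud : UniqueDiffOn ℝ K := uniqueDiffOn_convex hKconv
      ⟨EuclideanSpace.single 0 1, interior_mono hsub
        (by rw [isOpen_halfSpace.interior_eq]; simp [HalfSpace])⟩
    set S := K ∩ closedBall (0 : Euc d) (2 * R) with hS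
    have hScomp : IsCompact S := (isCompact_closedBall _ _).inter_left isClosed_closure
    obtain ⟨C, hC⟩ := hScomp.exists_bound_of_continuousOn
      ((hC1.continuousOn_fderivWithin hud (by norm_num)).mono inter_subset_left)
    have hCz : ∀ z ∈ HalfSpace d, ‖z‖ ≤ R → z ∈ S := fun z hz hzR =>
      ⟨hsub hz, by simpa using (by linarith [norm_nonneg z] : ‖z‖ ≤ 2 * R)⟩
    refine ⟨|C|, abs_nonneg C, fun z hz hzR => ⟨?_, ?_⟩⟩
    · have h1 := hC z (hCz z hz hzR)
      rw [fderivWithin_of_mem_nhds (mem_of_superset (isOpen_halfSpace.mem_nhds hz) hsub)] at h1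
      exact h1.trans (le_abs_self C)
    · have hz0 : 0 < z 0 := hz
      set p := z - z 0 • EuclideanSpace.single 0 (1 : ℝ) with hp
      have hzp : ‖z - p‖ = z 0 := by simp [hp, norm_smul, abs_of_pos hz0]
      have hpS : p ∈ S := by
        refine ⟨sub_coord_mem_closure z, ?_⟩
        have h1 : ‖p‖ ≤ ‖z‖ + ‖z - p‖ := by
          simpa using norm_sub_le z (z - p)
        have h2 := coord_zero_le_norm z
        rw [mem_closedBall_zero_iff]
        linarith
      have h := (hKconv.inter (convex_closedBall _ _)).norm_image_sub_le_of_norm_hasFDerivWithin_le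
        (fun x hx => ((hC1.differentiableOn (by norm_num) x hx.1).hasFDerivWithinAt.mono
          inter_subset_left)) hC hpS (hCz z hz hzR)
      rw [hbd p (by simp [hp]), sub_zero, hzp] at h
      exact h.trans (by gcongr; exact le_abs_self C)

lemma DirichletHarmonic.comp_smul {v : Euc d → ℝ} (hv : DirichletHarmonic v) {a : ℝ}
    (ha : 0 < a) : DirichletHarmonic fun z => v (a • z) where
  contDiffOn := hv.contDiffOn.comp (by fun_prop) fun z hz => (smul_mem_halfSpace_iff ha z).2 hz
  lap_eq_zero := by
    intro z hz
    have haz := (smul_mem_halfSpace_iff ha z).2 hz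
    have h1 : ∀ i : Fin (d + 2), fderiv ℝ (fun z' => fderiv ℝ (fun z => v (a • z)) z'
        (EuclideanSpace.single i 1)) z (EuclideanSpace.single i 1) =
        a * a * fderiv ℝ (fun z' => fderiv ℝ v z' (EuclideanSpace.single i 1)) (a • z)
          (EuclideanSpace.single i 1) := by
      intro i
      have hd : DifferentiableAt ℝ (fun z' => fderiv ℝ v z' (EuclideanSpace.single i 1)) (a • z) :=
        ((hv.contDiffOn_fderiv.clm_apply contDiffOn_const).contDiffAt
          (isOpen_halfSpace.mem_nhds haz)).differentiableAt (by norm_num)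
      have h2 : (fun z' => fderiv ℝ (fun z => v (a • z)) z' (EuclideanSpace.single i 1)) =
          fun z' => a * fderiv ℝ v (a • z') (EuclideanSpace.single i 1) := by
        ext z'
        rw [fderiv_comp_smul]
        simp
      have hd' : DifferentiableAt ℝ
          (fun z' => fderiv ℝ v (a • z') (EuclideanSpace.single i 1)) z :=
        DifferentiableAt.comp (f := fun z' : Euc d => a • z') z hd (by fun_prop)
      rw [h2, fderiv_const_mul hd',
        fderiv_comp_smul (f := fun z' => fderiv ℝ v z' (EuclideanSpace.single i 1))]
      simp [mul_assoc]
    have h3 := hv.lap_eq_zero _ haz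
    simp only [lapE] at h3 ⊢
    simp_rw [h1]
    rw [← Finset.mul_sum, h3, mul_zero]
  bound := by
    intro R
    obtain ⟨C, hC0, hC⟩ := hv.bound (a * R)
    refine ⟨a * C, by positivity, fun z hz hzR => ?_⟩
    have h := hC (a • z) ((smul_mem_halfSpace_iff ha z).2 hz)
      (by rw [norm_smul, Real.norm_eq_abs, abs_of_pos ha]; gcongr)
    constructor
    · rw [fderiv_comp_smul, norm_smul, Real.norm_eq_abs, abs_of_pos ha]
      gcongr
      exact h.1
    · refine h.2.trans (le_of_eq ?_)
      simp only [PiLp.smul_apply, smul_eq_mul]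
      ring

/-- The pairing `∫ v(xθ) v(yθ) dσ(θ)` of two dilates on the hemisphere. -/
def dilatePairing (v : Euc d → ℝ) (x y : ℝ) : ℝ :=
  ∫ θ in Hemisphere d, v (x • (θ : Euc d)) * v (y • (θ : Euc d)) ∂surf d

/-- The pairing of a dilate of `v` with the radial derivative of another dilate. -/
def fluxPairing (v : Euc d → ℝ) (x y : ℝ) : ℝ :=
  ∫ θ in Hemisphere d, v (x • (θ : Euc d)) *
    fderiv ℝ v (y • (θ : Euc d)) (y • (θ : Euc d)) ∂surf d

lemma fluxPairing_comm {v : Euc d → ℝ} (hv : DirichletHarmonic v) {x y : ℝ} (hx : 0 < x)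
    (hy : 0 < y) : fluxPairing v x y = fluxPairing v y x := by
  have key : ∀ {x y : ℝ}, 0 < x → 0 < y → fluxPairing v x y =
      ∫ z in HalfSpace d ∩ ball (0 : Euc d) 1, formDot (fderiv ℝ (fun z => v (x • z)) z)
        (fderiv ℝ (fun z => v (y • z)) z) := by
    intro x y hx hy
    rw [← green_halfBall (hv.comp_smul hx) (hv.comp_smul hy) one_pos]
    simp [fluxPairing, fderiv_comp_smul]
  rw [key hx hy, key hy hx]
  simp_rw [formDot_comm]

lemma exists_bound_apply {v : Euc d → ℝ} (hv : DirichletHarmonic v) (R : ℝ) :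
    ∃ C, 0 ≤ C ∧ ∀ z ∈ HalfSpace d, ‖z‖ ≤ R → |v z| ≤ C ∧ |fderiv ℝ v z z| ≤ C := by
  obtain ⟨C, hC0, hC⟩ := hv.bound R
  refine ⟨C * |R|, by positivity, fun z hz hzR => ⟨(hC z hz hzR).2.trans ?_, ?_⟩⟩
  · gcongr
    exact (coord_zero_le_norm z).trans (hzR.trans (le_abs_self R))
  · refine ((fderiv ℝ v z).le_opNorm z).trans ?_
    gcongr
    exacts [(hC z hz hzR).1, hzR.trans (le_abs_self R)]

lemma continuousOn_euler {v : Euc d → ℝ} (hv : DirichletHarmonic v) :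
    ContinuousOn (fun z => fderiv ℝ v z z) (HalfSpace d) :=
  hv.continuousOn_fderiv.clm_apply continuousOn_id

lemma integrable_mul_hemisphere {u w : Euc d → ℝ} (hu : ContinuousOn u (HalfSpace d))
    (hw : ContinuousOn w (HalfSpace d))
    (hbu : ∀ R : ℝ, ∃ C, ∀ z ∈ HalfSpace d, ‖z‖ ≤ R → |u z| ≤ C)
    (hbw : ∀ R : ℝ, ∃ C, ∀ z ∈ HalfSpace d, ‖z‖ ≤ R → |w z| ≤ C)
    {x y : ℝ} (hx : 0 < x) (hy : 0 < y) :
    IntegrableOn (fun θ : sphere (0 : Euc d) 1 => u (x • (θ : Euc d)) * w (y • (θ : Euc d)))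
      (Hemisphere d) (surf d) := by
  obtain ⟨A, hA⟩ := hbu x
  obtain ⟨B, hB⟩ := hbw y
  refine Integrable.mono' (g := fun _ => |A| * |B|) (integrable_const _)
    (((continuousOn_comp_smul hu hx).mul (continuousOn_comp_smul hw hy)).aestronglyMeasurable
      measurableSet_hemisphere) ?_
  filter_upwards [ae_restrict_mem measurableSet_hemisphere] with θ hθ
  rw [norm_mul]
  gcongr
  · exact (hA _ (hemisphere_smul_mem hx hθ) (norm_smul_sphere hx θ).le).trans (le_abs_self A)
  · exact (hB _ (hemisphere_smul_mem hy hθ) (norm_smul_sphere hy θ).le).trans (le_abs_self B)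

lemma hasDerivAt_dilatePairing {v : Euc d → ℝ} (hv : DirichletHarmonic v) (p q α β s : ℝ) :
    HasDerivAt (fun s => dilatePairing v (Real.exp (p + α * s)) (Real.exp (q + β * s)))
      (α * fluxPairing v (Real.exp (q + β * s)) (Real.exp (p + α * s)) +
        β * fluxPairing v (Real.exp (p + α * s)) (Real.exp (q + β * s))) s := by
  set X : ℝ := Real.exp (|p| + |α| * (|s| + 1)) + Real.exp (|q| + |β| * (|s| + 1)) with hX
  obtain ⟨C, hC0, hC⟩ := exists_bound_apply hv X
  have hle : ∀ p α t : ℝ, t ∈ ball s 1 →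
      Real.exp (p + α * t) ≤ Real.exp (|p| + |α| * (|s| + 1)) := by
    intro p α t ht
    rw [mem_ball, Real.dist_eq] at ht
    have h1 : |t| ≤ |s| + 1 := by
      have := abs_add_le (t - s) s
      rw [sub_add_cancel] at this
      linarith
    refine Real.exp_le_exp.2 (add_le_add (le_abs_self p) ((le_abs_self _).trans ?_))
    rw [abs_mul]
    gcongr
  have hpX : ∀ t ∈ ball s 1, Real.exp (p + α * t) ≤ X := fun t ht =>
    (hle p α t ht).trans (le_add_of_nonneg_right (Real.exp_pos _).le)
  have hqX : ∀ t ∈ ball s 1, Real.exp (q + β * t) ≤ X := fun t ht =>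
    (hle q β t ht).trans (le_add_of_nonneg_left (Real.exp_pos _).le)
  have hbv : ∀ R : ℝ, ∃ C, ∀ z ∈ HalfSpace d, ‖z‖ ≤ R → |v z| ≤ C := fun R =>
    (exists_bound_apply hv R).imp fun _ h z hz hR => (h.2 z hz hR).1
  have hbe : ∀ R : ℝ, ∃ C, ∀ z ∈ HalfSpace d, ‖z‖ ≤ R → |fderiv ℝ v z z| ≤ C := fun R =>
    (exists_bound_apply hv R).imp fun _ h z hz hR => (h.2 z hz hR).2
  have hint1 := integrable_mul_hemisphere hv.continuousOn (continuousOn_euler hv) hbv hbe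
    (Real.exp_pos (q + β * s)) (Real.exp_pos (p + α * s))
  have hint2 := integrable_mul_hemisphere hv.continuousOn (continuousOn_euler hv) hbv hbe
    (Real.exp_pos (p + α * s)) (Real.exp_pos (q + β * s))
  have hvd : ∀ (p α t : ℝ) (θ : sphere (0 : Euc d) 1), θ ∈ Hemisphere d →
      HasDerivAt (fun s => v (Real.exp (p + α * s) • (θ : Euc d)))
        (α * fderiv ℝ v (Real.exp (p + α * t) • (θ : Euc d))
          (Real.exp (p + α * t) • (θ : Euc d))) t := by
    intro p α t θ hθ
    have h1 : HasDerivAt (fun s => Real.exp (p + α * s)) (Real.exp (p + α * t) * (α * 1)) t :=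
      (((hasDerivAt_id t).const_mul α).const_add p).exp
    have h2 := (hv.differentiableAt (hemisphere_smul_mem (Real.exp_pos (p + α * t))
      hθ)).hasFDerivAt.comp_hasDerivAt t (h1.smul_const (θ : Euc d))
    refine h2.congr_deriv ?_
    simp only [map_smul, smul_eq_mul]
    ring
  have hmain := hasDerivAt_integral_of_dominated_loc_of_deriv_le
    (μ := (surf d).restrict (Hemisphere d)) (x₀ := s) (s := ball s 1)
    (F := fun s θ => v (Real.exp (p + α * s) • (θ : Euc d)) *
      v (Real.exp (q + β * s) • (θ : Euc d)))
    (F' := fun s θ => α * (v (Real.exp (q + β * s) • (θ : Euc d)) *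
        fderiv ℝ v (Real.exp (p + α * s) • (θ : Euc d)) (Real.exp (p + α * s) • (θ : Euc d))) +
      β * (v (Real.exp (p + α * s) • (θ : Euc d)) *
        fderiv ℝ v (Real.exp (q + β * s) • (θ : Euc d)) (Real.exp (q + β * s) • (θ : Euc d))))
    (bound := fun _ => |α| * (C * C) + |β| * (C * C)) (ball_mem_nhds s one_pos)
    (.of_forall fun t => (integrable_mul_hemisphere hv.continuousOn hv.continuousOn hbv hbv
      (Real.exp_pos _) (Real.exp_pos _)).aestronglyMeasurable)
    (integrable_mul_hemisphere hv.continuousOn hv.continuousOn hbv hbv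
      (Real.exp_pos _) (Real.exp_pos _))
    ((hint1.const_mul α).add (hint2.const_mul β)).aestronglyMeasurable
    (by
      filter_upwards [ae_restrict_mem measurableSet_hemisphere] with θ hθ t ht
      have e1 := hC _ (hemisphere_smul_mem (Real.exp_pos (p + α * t)) hθ)
        (by rw [norm_smul_sphere (Real.exp_pos _)]; exact hpX t ht)
      have e2 := hC _ (hemisphere_smul_mem (Real.exp_pos (q + β * t)) hθ)
        (by rw [norm_smul_sphere (Real.exp_pos _)]; exact hqX t ht)
      refine (norm_add_le _ _).trans ?_
      simp only [norm_mul, Real.norm_eq_abs]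
      gcongr
      exacts [e2.1, e1.2, e1.1, e2.2])
    (integrable_const _)
    (by
      filter_upwards [ae_restrict_mem measurableSet_hemisphere] with θ hθ t ht
      exact ((hvd p α t θ hθ).mul (hvd q β t θ hθ)).congr_deriv (by ring))
  have h := hmain.2
  rw [integral_add (hint1.const_mul α) (hint2.const_mul β), integral_const_mul,
    integral_const_mul] at h
  exact h

/-- The pairing of two dilates depends only on the product of the dilation factors. -/
lemma dilatePairing_exp {v : Euc d → ℝ} (hv : DirichletHarmonic v) (t s : ℝ) :
    dilatePairing v (Real.exp (t + s)) (Real.exp (t - s)) =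
      dilatePairing v (Real.exp t) (Real.exp t) := by
  have hd : ∀ s, HasDerivAt
      (fun s => dilatePairing v (Real.exp (t + 1 * s)) (Real.exp (t + (-1) * s))) 0 s := by
    intro s
    convert hasDerivAt_dilatePairing hv t t 1 (-1) s using 1
    rw [fluxPairing_comm hv (Real.exp_pos _) (Real.exp_pos _)]
    ring
  have := is_const_of_deriv_eq_zero (fun s => (hd s).differentiableAt) (fun s => (hd s).deriv) s 0
  simpa [← sub_eq_add_neg] using this

lemma dilatePairing_sq_le {v : Euc d → ℝ} (hv : DirichletHarmonic v) {x y : ℝ} (hx : 0 < x)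
    (hy : 0 < y) :
    dilatePairing v x y ^ 2 ≤ dilatePairing v x x * dilatePairing v y y := by
  have hbv : ∀ R : ℝ, ∃ C, ∀ z ∈ HalfSpace d, ‖z‖ ≤ R → |v z| ≤ C := fun R =>
    (exists_bound_apply hv R).imp fun _ h z hz hR => (h.2 z hz hR).1
  have hi : ∀ {x y : ℝ}, 0 < x → 0 < y → IntegrableOn (fun θ : sphere (0 : Euc d) 1 =>
      v (x • (θ : Euc d)) * v (y • (θ : Euc d))) (Hemisphere d) (surf d) := fun hx hy =>
    integrable_mul_hemisphere hv.continuousOn hv.continuousOn hbv hbv hx hy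
  have hquad : ∀ c : ℝ, 0 ≤ dilatePairing v y y * (c * c) + 2 * dilatePairing v x y * c +
      dilatePairing v x x := by
    intro c
    have h0 : 0 ≤ ∫ θ in Hemisphere d,
        (v (x • (θ : Euc d)) + c * v (y • (θ : Euc d))) ^ 2 ∂surf d :=
      integral_nonneg fun θ => sq_nonneg _
    have h1 : ∀ θ : sphere (0 : Euc d) 1,
        (v (x • (θ : Euc d)) + c * v (y • (θ : Euc d))) ^ 2 =
        c * c * (v (y • (θ : Euc d)) * v (y • (θ : Euc d))) +
          2 * c * (v (x • (θ : Euc d)) * v (y • (θ : Euc d))) +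
          v (x • (θ : Euc d)) * v (x • (θ : Euc d)) := fun θ => by ring
    simp_rw [h1] at h0
    have e1 := (hi hy hy).const_mul (c * c)
    have e2 := (hi hx hy).const_mul (2 * c)
    have e3 := integral_add (e1.add e2) (hi hx hx)
    simp only [Pi.add_apply] at e3
    rw [e3, integral_add e1 e2, integral_const_mul, integral_const_mul] at h0
    unfold dilatePairing
    linarith
  have := discrim_le_zero hquad
  rw [discrim] at this
  linarith

lemma dilatePairing_self_nonneg (v : Euc d → ℝ) (x : ℝ) : 0 ≤ dilatePairing v x x :=
  integral_nonneg fun _ => mul_self_nonneg _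

lemma dilatePairing_self_pos {v : Euc d → ℝ} (hv : DirichletHarmonic v)
    (hne : ∃ z ∈ HalfSpace d, v z ≠ 0) (t : ℝ) :
    0 < dilatePairing v (Real.exp t) (Real.exp t) := by
  refine lt_of_le_of_ne (dilatePairing_self_nonneg v _) fun h0 => ?_
  obtain ⟨z, hz, hvz⟩ := hne
  have hnz : 0 < ‖z‖ := norm_pos_iff.2 (ne_zero_of_mem_halfSpace hz)
  have hzero : dilatePairing v ‖z‖ ‖z‖ = 0 := by
    have h1 := dilatePairing_sq_le hv (Real.exp_pos (Real.log ‖z‖ + (Real.log ‖z‖ - t)))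
      (Real.exp_pos (Real.log ‖z‖ - (Real.log ‖z‖ - t)))
    rw [dilatePairing_exp hv, sub_sub_cancel, ← h0, mul_zero, Real.exp_log hnz] at h1
    exact pow_eq_zero_iff two_ne_zero |>.1 (le_antisymm h1 (sq_nonneg _))
  have hbv : ∀ R : ℝ, ∃ C, ∀ z ∈ HalfSpace d, ‖z‖ ≤ R → |v z| ≤ C := fun R =>
    (exists_bound_apply hv R).imp fun _ h z hz hR => (h.2 z hz hR).1
  have hae := (integral_eq_zero_iff_of_nonneg (fun _ => mul_self_nonneg _)
    (integrable_mul_hemisphere hv.continuousOn hv.continuousOn hbv hbv hnz hnz)).1 hzero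
  have hc := continuousOn_comp_smul hv.continuousOn hnz
  have heq := Measure.eqOn_open_of_ae_eq hae isOpen_hemisphere (hc.mul hc) continuousOn_const
  have hmem : ‖z‖⁻¹ • z ∈ sphere (0 : Euc d) 1 := by
    simp [norm_smul, hnz.ne']
  have := heq (x := ⟨‖z‖⁻¹ • z, hmem⟩) ((smul_mem_halfSpace_iff (inv_pos.2 hnz) z).2 hz)
  simp [smul_smul, hnz.ne', hvz] at this

lemma freqHS_eq_div {v : Euc d → ℝ} (hv : DirichletHarmonic v) {r : ℝ} (hr : 0 < r) :
    freqHS v r = fluxPairing v r r / dilatePairing v r r := by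
  have h1 : r ^ ((2 : ℝ) - ((d : ℝ) + 2)) = (r ^ d)⁻¹ := by
    rw [show (2 : ℝ) - ((d : ℝ) + 2) = -(d : ℝ) by ring, Real.rpow_neg hr.le, Real.rpow_natCast]
  have h2 := green_halfBall hv hv hr
  have h3 : ∀ z, gradSqE v z = formDot (fderiv ℝ v z) (fderiv ℝ v z) := fun z => by
    simp [gradSqE, formDot, pow_two]
  rw [freqHS, h1]
  simp_rw [h3]
  rw [← h2, inv_mul_cancel_left₀ (by positivity)]
  simp only [pow_two, fluxPairing, dilatePairing]

lemma deriv_le_of_midpoint_convex {L : ℝ → ℝ}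
    (hL : ∀ t s, 2 * L t ≤ L (t + s) + L (t - s)) {a b a' b' : ℝ} (hab : a < b)
    (ha : HasDerivAt L a' a) (hb : HasDerivAt L b' b) : a' ≤ b' := by
  have hinc : ∀ δ : ℝ, ∀ n : ℕ, L (a + δ) - L a ≤ L (a + n * δ + δ) - L (a + n * δ) := by
    intro δ n
    induction n with
    | zero => simp
    | succ n ih =>
      have := hL (a + n * δ + δ) δ
      rw [add_sub_cancel_right] at this
      rw [show a + ((n + 1 : ℕ) : ℝ) * δ = a + n * δ + δ by push_cast; ring]
      linarith
  have hδ : Tendsto (fun n : ℕ => (b - a) / ((n : ℝ) + 1)) atTop (nhdsWithin 0 {0}ᶜ) := by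
    refine tendsto_nhdsWithin_iff.2 ⟨?_, .of_forall fun n => ?_⟩
    · exact tendsto_const_nhds.div_atTop
        (tendsto_atTop_add_const_right _ _ tendsto_natCast_atTop_atTop)
    · exact (div_pos (sub_pos.2 hab) (by positivity)).ne'
  refine le_of_tendsto_of_tendsto ((hasDerivAt_iff_tendsto_slope_zero.1 ha).comp hδ)
    ((hasDerivAt_iff_tendsto_slope_zero.1 hb).comp hδ) (.of_forall fun n => ?_)
  have hpos : 0 < (b - a) / ((n : ℝ) + 1) := div_pos (sub_pos.2 hab) (by positivity)
  have h := hinc ((b - a) / ((n : ℝ) + 1)) (n + 1)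
  rw [show a + ((n + 1 : ℕ) : ℝ) * ((b - a) / ((n : ℝ) + 1)) = b by
    push_cast; field_simp; ring] at h
  simp only [Function.comp_apply, smul_eq_mul]
  gcongr

lemma monotoneOn_freqHS {v : Euc d → ℝ} (hv : DirichletHarmonic v)
    (hne : ∃ z ∈ HalfSpace d, v z ≠ 0) : MonotoneOn (freqHS v) (Ioi 0) := by
  set φ : ℝ → ℝ := fun t => dilatePairing v (Real.exp t) (Real.exp t) with hφ
  have hpos : ∀ t, 0 < φ t := dilatePairing_self_pos hv hne
  have hder : ∀ t, HasDerivAt (fun t => Real.log (φ t)) (2 * freqHS v (Real.exp t)) t := by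
    intro t
    have h := hasDerivAt_dilatePairing hv 0 0 1 1 t
    simp only [zero_add, one_mul] at h
    convert h.log (hpos t).ne' using 1
    rw [freqHS_eq_div hv (Real.exp_pos t)]
    ring
  have hmid : ∀ t s, 2 * Real.log (φ t) ≤ Real.log (φ (t + s)) + Real.log (φ (t - s)) := by
    intro t s
    have h := dilatePairing_sq_le hv (Real.exp_pos (t + s)) (Real.exp_pos (t - s))
    rw [dilatePairing_exp hv] at h
    rw [← Real.log_mul (hpos _).ne' (hpos _).ne', ← Nat.cast_ofNat (R := ℝ), ← Real.log_pow]
    exact Real.log_le_log (pow_pos (hpos t) 2) h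
  intro r hr R hR hrR
  have hr : 0 < r := hr
  rcases hrR.eq_or_lt with rfl | hlt
  · exact le_rfl
  have h := deriv_le_of_midpoint_convex hmid (Real.log_lt_log hr hlt) (hder _) (hder _)
  rw [Real.exp_log hr, Real.exp_log hR] at h
  linarith

end Frequency

/-- For `v` harmonic on the half-space, continuously differentiable up to
the closure, vanishing on `{z₁ = 0}` and not identically zero, the Almgren frequency
`N(v)(r)` is monotone nondecreasing on `(0,+∞)`. -/
theorem statement12 {d : ℕ} (v : EuclideanSpace ℝ (Fin (d+2)) → ℝ)
    (hC2 : ContDiffOn ℝ 2 v (HalfSpace d))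
    (hharm : ∀ z ∈ HalfSpace d, lapE v z = 0)
    (hC1 : ContDiffOn ℝ 1 v (closure (HalfSpace d)))
    (hbd : ∀ z : EuclideanSpace ℝ (Fin (d+2)), z 0 = 0 → v z = 0)
    (hnontriv : ∃ z ∈ HalfSpace d, v z ≠ 0) :
    MonotoneOn (freqHS v) (Ioi (0:ℝ)) := by
  exact monotoneOn_freqHS (dirichletHarmonic_of_contDiffOn_closure hC2 hharm hC1 hbd) hnontriv
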